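/- For all k, k' ∈ ℝ³ with k ≠ k', the integral ∫_{ℝ³} 1/(|p − k|² · |p − k'|²) dp converges and equals π³ / |k − k'|. -/

import Mathlib

open MeasureTheory

lemma aux_lint {α : Type*} [MeasurableSpace α] {μ : Measure α} {f : α → ℝ} {c : ℝ}
    (hf : 0 ≤ᵐ[μ] f) (h : ∫ x, f x ∂μ = c) (hc : c ≠ 0) :
    ∫⁻ x, ENNReal.ofReal (f x) ∂μ = ENNReal.ofReal c := by
  have hi : Integrable f μ := by
    by_contra hn
    exact hc (by rw [← h, integral_undef hn])
  rw [← h, ofReal_integral_eq_lintegral_ofReal hi hf]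

lemma aux_exp {A : ℝ} (hA : 0 < A) :
    ∫⁻ t in Set.Ioi (0:ℝ), ENNReal.ofReal (Real.exp (-(t * A))) = ENNReal.ofReal (1 / A) := by
  apply aux_lint
  · exact Filter.Eventually.of_forall fun t => (Real.exp_pos _).le
  · have := integral_exp_mul_Ioi (a := -A) (by linarith) 0
    simp only [mul_zero, Real.exp_zero] at this
    rw [← neg_div_neg_eq, ← this]
    congr 1; ext t; ring_nf
  · positivity

lemma aux_AB {A B : ℝ} (hA : 0 < A) (hB : 0 < B) :
    ENNReal.ofReal (1 / (A * B)) = ∫⁻ t in Set.Ioi (0:ℝ), ∫⁻ r in Set.Ioi (0:ℝ),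
      ENNReal.ofReal (t * Real.exp (-(t * (r * A + B)))) := by
  have h1 : ∀ t ∈ Set.Ioi (0:ℝ), ∫⁻ r in Set.Ioi (0:ℝ),
      ENNReal.ofReal (t * Real.exp (-(t * (r * A + B))))
      = ENNReal.ofReal (1 / A) * ENNReal.ofReal (Real.exp (-(t * B))) := by
    intro t ht
    have ht : 0 < t := ht
    have : ∀ r : ℝ, ENNReal.ofReal (t * Real.exp (-(t * (r * A + B))))
        = ENNReal.ofReal (t * Real.exp (-(t * B))) * ENNReal.ofReal (Real.exp (-(r * (t * A)))) := by
      intro r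
      rw [← ENNReal.ofReal_mul (by positivity), mul_assoc, ← Real.exp_add]
      ring_nf
    simp_rw [this]
    rw [lintegral_const_mul _ (by fun_prop), aux_exp (by positivity),
      ← ENNReal.ofReal_mul (by positivity), ← ENNReal.ofReal_mul (by positivity)]
    congr 1
    field_simp
  rw [setLIntegral_congr_fun measurableSet_Ioi h1, lintegral_const_mul _ (by fun_prop), aux_exp hB,
    ← ENNReal.ofReal_mul (by positivity)]
  congr 1
  field_simp

abbrev E3 := EuclideanSpace ℝ (Fin 3)

lemma aux_square (k k' p : E3) {r : ℝ} (hr : 0 < r) :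
    r * ‖p - k‖ ^ 2 + ‖p - k'‖ ^ 2
      = (1 + r) * ‖p - (1 + r)⁻¹ • (r • k + k')‖ ^ 2 + r / (1 + r) * ‖k - k'‖ ^ 2 := by
  have h : (1 + r) ≠ 0 := by positivity
  simp only [EuclideanSpace.norm_sq_eq, Fin.sum_univ_three, Real.norm_eq_abs, sq_abs,
    PiLp.sub_apply, PiLp.smul_apply, PiLp.add_apply, smul_eq_mul]
  field_simp
  ring

lemma aux_gauss (k k' : E3) {r t : ℝ} (hr : 0 < r) (ht : 0 < t) :
    ∫⁻ p : E3, ENNReal.ofReal (t * Real.exp (-(t * (r * ‖p - k‖ ^ 2 + ‖p - k'‖ ^ 2))))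
      = ENNReal.ofReal (Real.pi ^ (3/2 : ℝ) * (1 + r) ^ (-(3/2) : ℝ)) *
        ENNReal.ofReal (t ^ ((1/2 : ℝ) - 1) * Real.exp (-((r / (1 + r) * ‖k - k'‖ ^ 2) * t))) := by
  rw [← ENNReal.ofReal_mul (by positivity)]
  apply aux_lint
  · exact Filter.Eventually.of_forall fun p => by positivity
  · have h1 : ∀ p : E3, t * Real.exp (-(t * (r * ‖p - k‖ ^ 2 + ‖p - k'‖ ^ 2)))
      = (t * Real.exp (-((r / (1 + r) * ‖k - k'‖ ^ 2) * t))) *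
        (fun v : E3 => Real.exp (-(t * (1 + r)) * ‖v‖ ^ 2)) (p - (1 + r)⁻¹ • (r • k + k')) := by
      intro p
      simp only
      rw [aux_square k k' p hr, mul_assoc, ← Real.exp_add]
      ring_nf
    simp_rw [h1]
    rw [integral_const_mul, integral_sub_right_eq_self (fun v : E3 => Real.exp (-(t * (1 + r)) * ‖v‖ ^ 2)),
      GaussianFourier.integral_rexp_neg_mul_sq_norm (by positivity)]
    simp only [finrank_euclideanSpace, Fintype.card_fin, Nat.cast_ofNat]
    rw [Real.div_rpow (by positivity) (by positivity), Real.mul_rpow (by positivity) (by positivity),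
      Real.rpow_neg (by positivity)]
    have h2 : t ^ ((1/2 : ℝ) - 1) = t / t ^ (3 / 2 : ℝ) := by
      rw [show (1/2 : ℝ) - 1 = 1 - 3/2 by norm_num, Real.rpow_sub ht, Real.rpow_one]
    rw [h2]
    field_simp
  · positivity

lemma aux_gamma {a r : ℝ} (ha : 0 < a) (hr : 0 < r) :
    ENNReal.ofReal (Real.pi ^ (3/2 : ℝ) * (1 + r) ^ (-(3/2) : ℝ)) *
     ∫⁻ t in Set.Ioi (0:ℝ),
        ENNReal.ofReal (t ^ ((1/2 : ℝ) - 1) * Real.exp (-((r / (1 + r) * a ^ 2) * t)))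
      = ENNReal.ofReal (Real.pi ^ 2 / a) * ENNReal.ofReal (1 / (Real.sqrt r * (1 + r))) := by
  rw [aux_lint (c := (1 / (r / (1 + r) * a ^ 2)) ^ (1/2 : ℝ) * Real.Gamma (1/2)),
    ← ENNReal.ofReal_mul (by positivity), ← ENNReal.ofReal_mul (by positivity)]
  · congr 1
    rw [Real.Gamma_one_half_eq, ← Real.sqrt_eq_rpow, Real.rpow_neg (by positivity),
      show (3/2 : ℝ) = 1 + 1/2 by norm_num, Real.rpow_add (by positivity),
      Real.rpow_add (by positivity), ← Real.sqrt_eq_rpow, ← Real.sqrt_eq_rpow, Real.rpow_one,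
      Real.rpow_one, show 1 / (r / (1 + r) * a ^ 2) = (1 + r) / (r * a ^ 2) by field_simp,
      Real.sqrt_div (by positivity), Real.sqrt_mul hr.le, Real.sqrt_sq ha.le]
    have h1 := Real.sq_sqrt Real.pi_pos.le
    have h3 : 0 < √(1 + r) := by positivity
    field_simp
    rw [h1]
  · filter_upwards [ae_restrict_mem measurableSet_Ioi] with t ht
    have ht : 0 < t := ht
    simp only [Pi.zero_apply]
    positivity
  · exact Real.integral_rpow_mul_exp_neg_mul_Ioi (by norm_num) (by positivity)
  · have := Real.Gamma_pos_of_pos (show (0:ℝ) < 1/2 by norm_num)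
    positivity

lemma aux_arctan :
    ∫⁻ r in Set.Ioi (0:ℝ), ENNReal.ofReal (1 / (Real.sqrt r * (1 + r))) = ENNReal.ofReal Real.pi := by
  apply aux_lint
  · filter_upwards [ae_restrict_mem measurableSet_Ioi] with t ht
    have ht : 0 < t := ht
    simp only [Pi.zero_apply]
    positivity
  · have := integral_Ioi_of_hasDerivAt_of_nonneg (g := fun r => 2 * Real.arctan (Real.sqrt r))
      (g' := fun r => 1 / (Real.sqrt r * (1 + r))) (a := 0) (l := Real.pi) ?_ ?_ ?_ ?_
    · rw [this]; simp
    · exact (by fun_prop : Continuous fun r => 2 * Real.arctan (Real.sqrt r)).continuousWithinAt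
    · intro r hr
      have hr : 0 < r := hr
      have := ((Real.hasDerivAt_sqrt hr.ne').arctan).const_mul 2
      have e : 2 * (1 / (1 + √r ^ 2) * (1 / (2 * √r))) = 1 / (√r * (1 + r)) := by
        rw [Real.sq_sqrt hr.le]
        field_simp
      rw [e] at this
      exact this
    · intro r hr
      have hr : 0 < r := hr
      positivity
    · have h := ((Real.tendsto_arctan_atTop.mono_right nhdsWithin_le_nhds).comp
        Real.tendsto_sqrt_atTop).const_mul 2
      rw [show 2 * (Real.pi / 2) = Real.pi by ring] at h
      exact h
  · positivity

lemma aux_main (k k' : E3) (h : k ≠ k') :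
    ∫⁻ p : E3, ENNReal.ofReal (1 / (‖p - k‖ ^ 2 * ‖p - k'‖ ^ 2))
      = ENNReal.ofReal (Real.pi ^ 3 / ‖k - k'‖) := by
  have ha : 0 < ‖k - k'‖ := norm_pos_iff.2 (sub_ne_zero.2 h)
  have h1 : ∀ᵐ p : E3, ENNReal.ofReal (1 / (‖p - k‖ ^ 2 * ‖p - k'‖ ^ 2))
      = ∫⁻ t in Set.Ioi (0:ℝ), ∫⁻ r in Set.Ioi (0:ℝ),
      ENNReal.ofReal (t * Real.exp (-(t * (r * ‖p - k‖ ^ 2 + ‖p - k'‖ ^ 2)))) := by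
    filter_upwards [Measure.ae_ne volume k, Measure.ae_ne volume k'] with p hp hp'
    have := norm_pos_iff.2 (sub_ne_zero.2 hp)
    have := norm_pos_iff.2 (sub_ne_zero.2 hp')
    exact aux_AB (by positivity) (by positivity)
  rw [lintegral_congr_ae h1, lintegral_lintegral_swap]
  swap
  · apply Measurable.aemeasurable
    apply Measurable.lintegral_prod_right
    fun_prop
  have h2 : ∀ t ∈ Set.Ioi (0:ℝ), ∫⁻ p : E3, ∫⁻ r in Set.Ioi (0:ℝ),
      ENNReal.ofReal (t * Real.exp (-(t * (r * ‖p - k‖ ^ 2 + ‖p - k'‖ ^ 2))))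
      = ∫⁻ r in Set.Ioi (0:ℝ), ENNReal.ofReal (Real.pi ^ (3/2 : ℝ) * (1 + r) ^ (-(3/2) : ℝ)) *
        ENNReal.ofReal (t ^ ((1/2 : ℝ) - 1) * Real.exp (-((r / (1 + r) * ‖k - k'‖ ^ 2) * t))) := by
    intro t ht
    rw [lintegral_lintegral_swap (by apply Measurable.aemeasurable; fun_prop)]
    exact setLIntegral_congr_fun measurableSet_Ioi fun r hr => aux_gauss k k' hr ht
  rw [setLIntegral_congr_fun measurableSet_Ioi h2,
    lintegral_lintegral_swap (by apply Measurable.aemeasurable; fun_prop)]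
  have h3 : ∀ r ∈ Set.Ioi (0:ℝ), ∫⁻ t in Set.Ioi (0:ℝ),
      ENNReal.ofReal (Real.pi ^ (3/2 : ℝ) * (1 + r) ^ (-(3/2) : ℝ)) *
        ENNReal.ofReal (t ^ ((1/2 : ℝ) - 1) * Real.exp (-((r / (1 + r) * ‖k - k'‖ ^ 2) * t)))
      = ENNReal.ofReal (Real.pi ^ 2 / ‖k - k'‖) * ENNReal.ofReal (1 / (Real.sqrt r * (1 + r))) := by
    intro r hr
    rw [lintegral_const_mul _ (by fun_prop), aux_gamma ha hr]
  rw [setLIntegral_congr_fun measurableSet_Ioi h3, lintegral_const_mul _ (by fun_prop), aux_arctan,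
    ← ENNReal.ofReal_mul (by positivity)]
  congr 1
  ring

/-- For `k ≠ k'` in `ℝ³`, `∫ dp / (|p−k|²|p−k'|²) = π³/|k−k'|`, the integral being convergent. -/
theorem stmt_2 (k k' : EuclideanSpace ℝ (Fin 3)) (h : k ≠ k') :
    Integrable (fun p : EuclideanSpace ℝ (Fin 3) => 1 / (‖p - k‖ ^ 2 * ‖p - k'‖ ^ 2)) ∧
    ∫ p : EuclideanSpace ℝ (Fin 3), 1 / (‖p - k‖ ^ 2 * ‖p - k'‖ ^ 2)
      = Real.pi ^ 3 / ‖k - k'‖ := by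
  have hm : AEStronglyMeasurable
      (fun p : EuclideanSpace ℝ (Fin 3) => 1 / (‖p - k‖ ^ 2 * ‖p - k'‖ ^ 2)) volume :=
    Measurable.aestronglyMeasurable (by fun_prop)
  have hn : 0 ≤ᵐ[volume]
      (fun p : EuclideanSpace ℝ (Fin 3) => 1 / (‖p - k‖ ^ 2 * ‖p - k'‖ ^ 2)) :=
    Filter.Eventually.of_forall fun p => by simp only [Pi.zero_apply]; positivity
  have hL := aux_main k k' h
  constructor
  · refine ⟨hm, ?_⟩
    rw [hasFiniteIntegral_iff_ofReal hn, hL]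
    exact ENNReal.ofReal_lt_top
  · rw [integral_eq_lintegral_of_nonneg_ae hn hm, hL, ENNReal.toReal_ofReal (by positivity)]
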